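/- arXiv:2307.02597 — 4 statements merged into one kernel-verified Lean document; each statement's English description precedes it below -/
import Mathlib

section
/- Let a < b be real numbers, let α₁, α₂, β₁, β₂ ∈ ℝ, and let f : [a,b] × ℝ → ℝ be continuous, bounded above by a constant M ∈ ℝ, and nonincreasing in its second argument. Then there exists exactly one four-times continuously differentiable function w : [a,b] → ℝ satisfying w⁗(x) = f(x, w(x)) for all x ∈ [a,b] together with the boundary conditions w(a) = α₁, w(b) = α₂, w''(a) = β₁, w''(b) = β₂. -/
open Set
open MeasureTheory Filter Topology
open scoped RealInnerProductSpace

theorem exists_fixedPoint_of_concave_gradient {H : Type*} [NormedAddCommGroup H]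
    [InnerProductSpace ℝ H] [CompleteSpace H] (Φ : H → ℝ) (N : H → H)
    (hΦ : ∀ u v, Φ v - Φ u ≤ ⟪N u, v - u⟫) (hN : ∀ u φ, Continuous fun t : ℝ => N (u + t • φ)) :
    ∃ u, N u = u := by
  set J : H → ℝ := fun u => ‖u‖ ^ 2 / 2 - Φ u with hJ
  have tangent : ∀ u v, ⟪u - N u, v - u⟫ + ‖v - u‖ ^ 2 / 2 ≤ J v - J u := by
    intro u v
    have h1 := hΦ u v
    have h2 : ‖v‖ ^ 2 = ‖u‖ ^ 2 + 2 * ⟪u, v - u⟫ + ‖v - u‖ ^ 2 := by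
      rw [← norm_add_sq_real]; simp
    simp only [hJ, inner_sub_left]
    linarith
  have bdd : BddBelow (range J) := by
    refine ⟨J 0 - ‖N 0‖ ^ 2 / 2, ?_⟩
    rintro _ ⟨v, rfl⟩
    have h1 := tangent 0 v
    have h2 := real_inner_le_norm (N 0) v
    simp only [zero_sub, sub_zero, inner_neg_left] at h1
    nlinarith [sq_nonneg (‖v‖ - ‖N 0‖)]
  set m := sInf (range J) with hm
  have hmle : ∀ v, m ≤ J v := fun v => csInf_le bdd ⟨v, rfl⟩
  have hseq : ∀ n : ℕ, ∃ u, J u < m + 1 / ((n : ℝ) + 1) := by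
    intro n
    obtain ⟨_, ⟨u, rfl⟩, hu⟩ := exists_lt_of_csInf_lt (range_nonempty J)
      (lt_add_of_pos_right m (Nat.one_div_pos_of_nat (α := ℝ) (n := n)))
    exact ⟨u, hu⟩
  choose u hu using hseq
  have hdist : ∀ v w, ‖v - w‖ ^ 2 ≤ 4 * (J v - m) + 4 * (J w - m) := by
    intro v w
    set c : H := (2⁻¹ : ℝ) • (v + w)
    have e1 : v - c = (2⁻¹ : ℝ) • (v - w) := by simp only [c]; module
    have e2 : w - c = -((2⁻¹ : ℝ) • (v - w)) := by simp only [c]; module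
    have h1 := tangent c v
    have h2 := tangent c w
    rw [e1] at h1
    rw [e2, inner_neg_right, norm_neg] at h2
    have h3 : ‖(2⁻¹ : ℝ) • (v - w)‖ ^ 2 = ‖v - w‖ ^ 2 / 4 := by
      rw [norm_smul, mul_pow]; norm_num; ring
    rw [h3] at h1 h2
    linarith [hmle c]
  have hlim : Tendsto (fun n : ℕ => 1 / ((n : ℝ) + 1)) atTop (𝓝 0) :=
    tendsto_one_div_add_atTop_nhds_zero_nat
  have hcauchy : CauchySeq u := by
    refine cauchySeq_of_le_tendsto_0 (fun n : ℕ => √(8 * (1 / ((n : ℝ) + 1)))) ?_ ?_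
    · intro n k l hnk hnl
      rw [dist_eq_norm]
      apply Real.le_sqrt_of_sq_le
      have h1 := Nat.one_div_le_one_div (α := ℝ) hnk
      have h2 := Nat.one_div_le_one_div (α := ℝ) hnl
      linarith [hdist (u n) (u k), hu n, hu k]
    · simpa using (hlim.const_mul 8).sqrt
  obtain ⟨z, hz⟩ := cauchySeq_tendsto_of_complete hcauchy
  have hJz : J z ≤ m := by
    have h1 : Tendsto (fun n => J z + ⟪z - N z, u n - z⟫) atTop (𝓝 (J z)) := by
      have : Tendsto (fun n => u n - z) atTop (𝓝 0) := by simpa using hz.sub_const z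
      simpa using ((tendsto_const_nhds (x := z - N z)).inner this).const_add (J z)
    have h2 : Tendsto (fun n : ℕ => m + 1 / ((n : ℝ) + 1)) atTop (𝓝 m) := by
      simpa using hlim.const_add m
    refine le_of_tendsto_of_tendsto' h1 h2 fun n => ?_
    nlinarith [tangent z (u n), hu n, sq_nonneg ‖u n - z‖]
  have hvar : ∀ φ, 0 ≤ ⟪z - N z, φ⟫ := by
    intro φ
    have hcont : Continuous fun t : ℝ => ⟪(z + t • φ) - N (z + t • φ), φ⟫ :=
      ((by fun_prop : Continuous fun t : ℝ => z + t • φ).sub (hN z φ)).inner continuous_const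
    have h1 : Tendsto (fun t : ℝ => ⟪(z + t • φ) - N (z + t • φ), φ⟫) (𝓝[>] 0)
        (𝓝 ⟪z - N z, φ⟫) := by
      simpa using (hcont.tendsto 0).mono_left nhdsWithin_le_nhds
    refine ge_of_tendsto h1 ?_
    filter_upwards [self_mem_nhdsWithin] with t (ht : 0 < t)
    have h2 := tangent (z + t • φ) z
    have e : z - (z + t • φ) = -(t • φ) := by module
    rw [e, inner_neg_right, inner_smul_right] at h2
    have h3 := hmle (z + t • φ)
    have h4 : 0 ≤ t * ⟪(z + t • φ) - N (z + t • φ), φ⟫ := by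
      nlinarith [sq_nonneg ‖-(t • φ)‖]
    exact nonneg_of_mul_nonneg_right h4 ht
  have h := hvar (-(z - N z))
  rw [inner_neg_right, real_inner_self_eq_norm_sq] at h
  have h0 : ‖z - N z‖ = 0 := by nlinarith [norm_nonneg (z - N z)]
  exact ⟨z, (sub_eq_zero.1 (norm_eq_zero.1 h0)).symm⟩

theorem integral_sub_le_of_antitone {f : ℝ → ℝ} (hf : Continuous f) (hf' : Antitone f) (y z : ℝ) :
    (∫ t in (0 : ℝ)..z, f t) - (∫ t in (0 : ℝ)..y, f t) ≤ f y * (z - y) := by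
  rw [intervalIntegral.integral_interval_sub_left (hf.intervalIntegrable _ _)
    (hf.intervalIntegrable _ _)]
  have hc : ∀ p q : ℝ, ∫ _ in p..q, f y = f y * (q - p) := fun p q => by
    rw [intervalIntegral.integral_const, smul_eq_mul, mul_comm]
  rcases le_total y z with h | h
  · rw [← hc]
    exact intervalIntegral.integral_mono_on h (hf.intervalIntegrable _ _)
      intervalIntegrable_const fun t ht => hf' ht.1
  · rw [intervalIntegral.integral_symm]
    have := intervalIntegral.integral_mono_on h (μ := volume) (f := fun _ => f y)
      (continuous_const.intervalIntegrable _ _)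
      (hf.intervalIntegrable z y) fun t ht => hf' ht.2
    rw [hc] at this
    linarith

theorem exists_eq_integral_smul_of_antitone {H : Type*} [NormedAddCommGroup H]
    [InnerProductSpace ℝ H] [CompleteSpace H] {a b : ℝ} (hab : a ≤ b) {f : ℝ → ℝ → ℝ}
    (hf : Continuous fun p : ℝ × ℝ => f p.1 p.2) (hf' : ∀ x, Antitone (f x))
    {k : ℝ → H} (hk : Continuous k) :
    ∃ u : H, ∫ x in a..b, f x ⟪k x, u⟫ • k x = u := by
  have hF : Continuous fun p : ℝ × ℝ => ∫ t in (0 : ℝ)..p.2, f p.1 t :=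
    intervalIntegral.continuous_parametric_intervalIntegral_of_continuous
      (f := fun (p : ℝ × ℝ) t => f p.1 t) (by fun_prop) continuous_snd
  have hFu : ∀ u : H, Continuous fun x => ∫ t in (0 : ℝ)..⟪k x, u⟫, f x t := fun u =>
    hF.comp (g := fun p : ℝ × ℝ => ∫ t in (0 : ℝ)..p.2, f p.1 t)
      (f := fun x => (x, ⟪k x, u⟫)) (by fun_prop)
  have hNu : ∀ u : H, Continuous fun x => f x ⟪k x, u⟫ • k x := fun u =>
    (hf.comp (g := fun p : ℝ × ℝ => f p.1 p.2)
      (f := fun x => (x, ⟪k x, u⟫)) (by fun_prop)).smul hk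
  refine exists_fixedPoint_of_concave_gradient
    (fun u => ∫ x in a..b, ∫ t in (0 : ℝ)..⟪k x, u⟫, f x t) _ ?_ ?_
  · intro u v
    rw [← intervalIntegral.integral_sub ((hFu v).intervalIntegrable _ _)
      ((hFu u).intervalIntegrable _ _), real_inner_comm, ← innerSL_apply_apply ℝ,
      ← ContinuousLinearMap.intervalIntegral_comp_comm _ ((hNu u).intervalIntegrable _ _)]
    refine intervalIntegral.integral_mono_on hab
      (((hFu v).sub (hFu u)).intervalIntegrable _ _)
      (((innerSL ℝ (v - u)).continuous.comp (hNu u)).intervalIntegrable _ _) fun x _ => ?_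
    have := integral_sub_le_of_antitone (f := f x)
      (hf.comp (f := fun y => (x, y)) (by fun_prop)) (hf' x) ⟪k x, u⟫ ⟪k x, v⟫
    rwa [innerSL_apply_apply, inner_smul_right, real_inner_comm (k x) (v - u), inner_sub_right]
  · intro u φ
    refine intervalIntegral.continuous_parametric_intervalIntegral_of_continuous'
      (f := fun (t x : ℝ) => f x ⟪k x, u + t • φ⟫ • k x) ?_ a b
    exact (hf.comp (g := fun p : ℝ × ℝ => f p.1 p.2)
      (f := fun q : ℝ × ℝ => (q.2, ⟪k q.2, u + q.1 • φ⟫)) (by fun_prop)).smul (by fun_prop)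


theorem exists_eq_integral_integral_of_antitone {a b : ℝ} (hab : a ≤ b) {f : ℝ → ℝ → ℝ}
    (hf : Continuous fun p : ℝ × ℝ => f p.1 p.2) (hf' : ∀ x, Antitone (f x))
    {g : ℝ → ℝ → ℝ} (hg : Continuous fun p : ℝ × ℝ => g p.1 p.2) :
    ∃ W : ℝ → ℝ, Continuous W ∧
      ∀ y, W y = ∫ s in a..b, g y s * ∫ x in a..b, g x s * f x (W x) := by
  let μ : Measure (Icc a b) := volume.comap Subtype.val
  have : IsFiniteMeasure μ := ⟨by
    rw [comap_subtype_coe_apply measurableSet_Icc, image_univ, Subtype.range_coe]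
    exact measure_Icc_lt_top⟩
  let G : C(ℝ, C(Icc a b, ℝ)) :=
    ContinuousMap.curry ⟨fun p : ℝ × Icc a b => g p.1 p.2, by fun_prop⟩
  let T : C(Icc a b, ℝ) →L[ℝ] Lp ℝ 2 μ := ContinuousMap.toLp 2 μ ℝ
  have hk : Continuous fun x => T (G x) := T.continuous.comp G.continuous
  obtain ⟨u, hu⟩ := exists_eq_integral_smul_of_antitone hab hf hf' hk
  set W : ℝ → ℝ := fun y => ⟪T (G y), u⟫ with hW
  have hWc : Continuous W := hk.inner continuous_const
  have hc : Continuous fun x => f x (W x) :=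
    hf.comp (g := fun p : ℝ × ℝ => f p.1 p.2) (f := fun x => (x, W x)) (by fun_prop)
  have hcG : Continuous fun x => f x (W x) • G x := hc.smul G.continuous
  set U : C(Icc a b, ℝ) := ∫ x in a..b, f x (W x) • G x
  have hTU : T U = u := by
    rw [← T.intervalIntegral_comp_comm (hcG.intervalIntegrable _ _)]
    simpa only [map_smul] using hu
  have hUs : ∀ s, U s = ∫ x in a..b, g x s * f x (W x) := by
    intro s
    have := (ContinuousMap.evalCLM ℝ s).intervalIntegral_comp_comm (hcG.intervalIntegrable (μ := volume) a b)
    refine this.symm.trans ?_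
    congr 1
    ext x
    exact mul_comm _ _
  refine ⟨W, hWc, fun y => ?_⟩
  have h1 : W y = ⟪T (G y), T U⟫ := by rw [hTU]
  rw [h1, ContinuousMap.inner_toLp, intervalIntegral.integral_of_le hab,
    ← integral_Icc_eq_integral_Ioc, ← integral_subtype_comap measurableSet_Icc]
  congr 1
  ext s
  rw [hUs]
  exact mul_comm _ _

/-- The Green function of `-d²/dx²` on `[a, b]` with Dirichlet boundary conditions. -/
noncomputable def dirichletGreen (a b x s : ℝ) : ℝ :=
  (min x s - a) * (b - max x s) / (b - a)

theorem dirichletGreen_comm (a b x s : ℝ) : dirichletGreen a b x s = dirichletGreen a b s x := by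
  rw [dirichletGreen, min_comm, max_comm, dirichletGreen]

theorem continuous_dirichletGreen (a b : ℝ) :
    Continuous fun p : ℝ × ℝ => dirichletGreen a b p.1 p.2 := by
  unfold dirichletGreen
  fun_prop

/-- The solution `u` of `-u'' = c`, `u a = u b = 0`, written with primitives of `c`. -/
noncomputable def dirichletSolution (a b : ℝ) (c : ℝ → ℝ) (y : ℝ) : ℝ :=
  ((b - y) * (∫ s in a..y, (s - a) * c s) - (y - a) * ∫ s in b..y, (b - s) * c s) / (b - a)

theorem dirichletSolution_left (a b : ℝ) (c : ℝ → ℝ) : dirichletSolution a b c a = 0 := by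
  simp [dirichletSolution]

theorem dirichletSolution_right (a b : ℝ) (c : ℝ → ℝ) : dirichletSolution a b c b = 0 := by
  simp [dirichletSolution]

theorem integral_dirichletGreen_mul {a b y : ℝ} (hy : y ∈ Icc a b) {c : ℝ → ℝ}
    (hc : Continuous c) :
    ∫ s in a..b, dirichletGreen a b y s * c s = dirichletSolution a b c y := by
  have hG : Continuous fun s => dirichletGreen a b y s * c s :=
    ((continuous_dirichletGreen a b).comp (f := fun s => (y, s)) (by fun_prop)).mul hc
  rw [← intervalIntegral.integral_add_adjacent_intervals (hG.intervalIntegrable a y)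
    (hG.intervalIntegrable y b)]
  have h1 : ∫ s in a..y, dirichletGreen a b y s * c s =
      (b - y) / (b - a) * ∫ s in a..y, (s - a) * c s := by
    rw [← intervalIntegral.integral_const_mul]
    refine intervalIntegral.integral_congr fun s hs => ?_
    rw [uIcc_of_le hy.1] at hs
    simp only [dirichletGreen, min_eq_right hs.2, max_eq_left hs.2]
    ring
  have h2 : ∫ s in y..b, dirichletGreen a b y s * c s =
      (y - a) / (b - a) * ∫ s in y..b, (b - s) * c s := by
    rw [← intervalIntegral.integral_const_mul]
    refine intervalIntegral.integral_congr fun s hs => ?_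
    rw [uIcc_of_le hy.2] at hs
    simp only [dirichletGreen, min_eq_left hs.1, max_eq_right hs.1]
    ring
  rw [h1, h2, intervalIntegral.integral_symm b y, dirichletSolution]
  ring

theorem exists_hasDerivAt_dirichletSolution {a b : ℝ} (hab : a < b) {c : ℝ → ℝ}
    (hc : Continuous c) :
    ∃ v : ℝ → ℝ, ∀ y, HasDerivAt (dirichletSolution a b c) (v y) y ∧ HasDerivAt v (-c y) y := by
  have hba : b - a ≠ 0 := sub_ne_zero.2 hab.ne'
  have hP : ∀ y, HasDerivAt (fun y => ∫ s in a..y, (s - a) * c s) ((y - a) * c y) y := fun y =>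
    ((by fun_prop : Continuous fun s => (s - a) * c s).integral_hasStrictDerivAt a y).hasDerivAt
  have hQ : ∀ y, HasDerivAt (fun y => ∫ s in b..y, (b - s) * c s) ((b - y) * c y) y := fun y =>
    ((by fun_prop : Continuous fun s => (b - s) * c s).integral_hasStrictDerivAt b y).hasDerivAt
  refine ⟨fun y => (-(∫ s in a..y, (s - a) * c s) - ∫ s in b..y, (b - s) * c s) / (b - a),
    fun y => ⟨?_, ?_⟩⟩
  · refine (((((hasDerivAt_id y).const_sub b).mul (hP y)).sub
      (((hasDerivAt_id y).sub_const a).mul (hQ y))).div_const (b - a)).congr_deriv ?_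
    simp only [id]
    ring
  · refine (((hP y).neg.sub (hQ y)).div_const (b - a)).congr_deriv ?_
    field_simp
    ring

theorem contDiff_four_of_hasDerivAt {w₀ w₁ w₂ w₃ w₄ : ℝ → ℝ}
    (h₀ : ∀ x, HasDerivAt w₀ (w₁ x) x) (h₁ : ∀ x, HasDerivAt w₁ (w₂ x) x)
    (h₂ : ∀ x, HasDerivAt w₂ (w₃ x) x) (h₃ : ∀ x, HasDerivAt w₃ (w₄ x) x)
    (h₄ : Continuous w₄) :
    ContDiff ℝ 4 w₀ ∧ iteratedDeriv 2 w₀ = w₂ ∧ iteratedDeriv 4 w₀ = w₄ := by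
  have e₀ : deriv w₀ = w₁ := funext fun x => (h₀ x).deriv
  have e₁ : deriv w₁ = w₂ := funext fun x => (h₁ x).deriv
  have e₂ : deriv w₂ = w₃ := funext fun x => (h₂ x).deriv
  have e₃ : deriv w₃ = w₄ := funext fun x => (h₃ x).deriv
  refine ⟨?_, ?_, ?_⟩
  · have c₄ : ContDiff ℝ 0 w₄ := contDiff_zero.2 h₄
    have c₃ : ContDiff ℝ (0 + 1) w₃ := contDiff_succ_iff_deriv.2
      ⟨fun x => (h₃ x).differentiableAt, by simp, e₃ ▸ c₄⟩
    have c₂ : ContDiff ℝ (0 + 1 + 1) w₂ := contDiff_succ_iff_deriv.2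
      ⟨fun x => (h₂ x).differentiableAt, by simp, e₂ ▸ c₃⟩
    have c₁ : ContDiff ℝ (0 + 1 + 1 + 1) w₁ := contDiff_succ_iff_deriv.2
      ⟨fun x => (h₁ x).differentiableAt, by simp, e₁ ▸ c₂⟩
    have c₀ : ContDiff ℝ (0 + 1 + 1 + 1 + 1) w₀ := contDiff_succ_iff_deriv.2
      ⟨fun x => (h₀ x).differentiableAt, by simp, e₀ ▸ c₁⟩
    convert c₀ using 1
    norm_num
  · simp only [iteratedDeriv_succ', iteratedDeriv_zero, e₀, e₁]
  · simp only [iteratedDeriv_succ', iteratedDeriv_zero, e₀, e₁, e₂, e₃]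

theorem eq_zero_of_hasDerivAt_nonneg {a b : ℝ} {h h' : ℝ → ℝ}
    (hc : ContinuousOn h (Icc a b)) (hd : ∀ x ∈ Ioo a b, HasDerivAt h (h' x) x)
    (hpos : ∀ x ∈ Ioo a b, 0 ≤ h' x) (hends : h a = h b) : ∀ x ∈ Ioo a b, h' x = 0 := by
  have hmono : MonotoneOn h (Icc a b) := by
    refine monotoneOn_of_deriv_nonneg (convex_Icc a b) hc ?_ ?_
    · rw [interior_Icc]
      exact fun x hx => (hd x hx).differentiableAt.differentiableWithinAt
    · rw [interior_Icc]
      exact fun x hx => (hd x hx).deriv ▸ hpos x hx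
  intro x hx
  have hab : a ≤ b := (hx.1.trans hx.2).le
  have hconst : ∀ y ∈ Ioo a b, h y = h a := fun y hy =>
    le_antisymm
      ((hmono ⟨hy.1.le, hy.2.le⟩ (right_mem_Icc.2 hab) hy.2.le).trans_eq hends.symm)
      (hmono (left_mem_Icc.2 hab) ⟨hy.1.le, hy.2.le⟩ hy.1.le)
  refine (hd x hx).unique ((hasDerivAt_const x (h a)).congr_of_eventuallyEq ?_)
  filter_upwards [Ioo_mem_nhds hx.1 hx.2] with y hy using hconst y hy

theorem eqOn_zero_of_mul_fourth_deriv_nonpos {a b : ℝ} {d₀ d₁ d₂ d₃ d₄ : ℝ → ℝ}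
    (c₀ : ContinuousOn d₀ (Icc a b)) (c₁ : ContinuousOn d₁ (Icc a b))
    (c₂ : ContinuousOn d₂ (Icc a b)) (c₃ : ContinuousOn d₃ (Icc a b))
    (h₀ : ∀ x ∈ Ioo a b, HasDerivAt d₀ (d₁ x) x) (h₁ : ∀ x ∈ Ioo a b, HasDerivAt d₁ (d₂ x) x)
    (h₂ : ∀ x ∈ Ioo a b, HasDerivAt d₂ (d₃ x) x) (h₃ : ∀ x ∈ Ioo a b, HasDerivAt d₃ (d₄ x) x)
    (hneg : ∀ x ∈ Ioo a b, d₀ x * d₄ x ≤ 0)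
    (ha : d₀ a = 0) (hb : d₀ b = 0) (ha' : d₂ a = 0) (hb' : d₂ b = 0) :
    ∀ x ∈ Icc a b, d₀ x = 0 := by
  have hE := eq_zero_of_hasDerivAt_nonneg (h := fun x => d₁ x * d₂ x - d₀ x * d₃ x)
    (h' := fun x => d₂ x ^ 2 - d₀ x * d₄ x) ((c₁.mul c₂).sub (c₀.mul c₃))
    (fun x hx => (((h₁ x hx).mul (h₂ x hx)).sub ((h₀ x hx).mul (h₃ x hx))).congr_deriv (by ring))
    (fun x hx => by nlinarith [hneg x hx, sq_nonneg (d₂ x)]) (by simp [ha, hb, ha', hb'])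
  have hd₂ : ∀ x ∈ Ioo a b, d₂ x = 0 := fun x hx =>
    pow_eq_zero_iff two_ne_zero |>.1
      (le_antisymm (by linarith [hE x hx, hneg x hx]) (sq_nonneg (d₂ x)))
  have hE' := eq_zero_of_hasDerivAt_nonneg (h := fun x => d₀ x * d₁ x)
    (h' := fun x => d₁ x ^ 2) (c₀.mul c₁)
    (fun x hx => ((h₀ x hx).mul (h₁ x hx)).congr_deriv (by rw [hd₂ x hx]; ring))
    (fun x _ => sq_nonneg (d₁ x)) (by simp [ha, hb])
  intro x hx
  rcases hx.1.eq_or_lt with rfl | hax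
  · exact ha
  obtain ⟨z, hz, hz'⟩ := exists_hasDerivAt_eq_slope d₀ d₁ hax (c₀.mono (Icc_subset_Icc_right hx.2))
    fun y hy => h₀ y ⟨hy.1, hy.2.trans_le hx.2⟩
  have hd₁ : d₁ z = 0 := pow_eq_zero_iff two_ne_zero |>.1 (hE' z ⟨hz.1, hz.2.trans_le hx.2⟩)
  rw [hd₁, ha, sub_zero, eq_comm, div_eq_zero_iff] at hz'
  exact hz'.resolve_right (sub_pos.2 hax).ne'

theorem ContDiffOn.hasDerivAt_iteratedDerivWithin_Icc {a b : ℝ} {w : ℝ → ℝ} {n : ℕ}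
    (hw : ContDiffOn ℝ n w (Icc a b)) {m : ℕ} (hm : m < n) {x : ℝ} (hx : x ∈ Ioo a b) :
    HasDerivAt (iteratedDerivWithin m w (Icc a b)) (iteratedDerivWithin (m + 1) w (Icc a b) x) x := by
  have hu := uniqueDiffOn_Icc (hx.1.trans hx.2)
  have h := hw.differentiableOn_iteratedDerivWithin (m := m) (by exact_mod_cast hm) hu x
    (Ioo_subset_Icc_self hx)
  rw [iteratedDerivWithin_succ]
  exact h.hasDerivWithinAt.hasDerivAt (Icc_mem_nhds hx.1 hx.2)

/-- **Existence and uniqueness** for the Euler–Bernoulli fourth-order BVP `w⁗ = f(x,w)`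
on `[a,b]` with boundary conditions `w a = α₁`, `w b = α₂`, `w'' a = β₁`, `w'' b = β₂`,
when `f` is continuous, bounded above by `M`, and nonincreasing in its second argument:
there is exactly one solution (as a function on `[a,b]`). -/
theorem bvp_existence_uniqueness (a b : ℝ) (hab : a < b) (α₁ α₂ β₁ β₂ M : ℝ)
    (f : ℝ → ℝ → ℝ)
    (hf_cont : ContinuousOn (fun p : ℝ × ℝ => f p.1 p.2) (Set.Icc a b ×ˢ Set.univ))
    (hf_bdd : ∀ x ∈ Set.Icc a b, ∀ y : ℝ, f x y ≤ M)
    (hf_mono : ∀ x ∈ Set.Icc a b, ∀ y₁ y₂ : ℝ, y₂ ≤ y₁ → f x y₁ ≤ f x y₂) :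
    ∃ w : ℝ → ℝ,
      (ContDiffOn ℝ 4 w (Set.Icc a b) ∧
        (∀ x ∈ Set.Icc a b, iteratedDerivWithin 4 w (Set.Icc a b) x = f x (w x)) ∧
        w a = α₁ ∧ w b = α₂ ∧
        iteratedDerivWithin 2 w (Set.Icc a b) a = β₁ ∧
        iteratedDerivWithin 2 w (Set.Icc a b) b = β₂) ∧
      (∀ w' : ℝ → ℝ,
        (ContDiffOn ℝ 4 w' (Set.Icc a b) ∧
          (∀ x ∈ Set.Icc a b, iteratedDerivWithin 4 w' (Set.Icc a b) x = f x (w' x)) ∧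
          w' a = α₁ ∧ w' b = α₂ ∧
          iteratedDerivWithin 2 w' (Set.Icc a b) a = β₁ ∧
          iteratedDerivWithin 2 w' (Set.Icc a b) b = β₂) →
        Set.EqOn w' w (Set.Icc a b)) := by
  have hba : b - a ≠ 0 := sub_ne_zero.2 hab.ne'
  have hu : UniqueDiffOn ℝ (Icc a b) := uniqueDiffOn_Icc hab
  have haI : a ∈ Icc a b := left_mem_Icc.2 hab.le
  have hbI : b ∈ Icc a b := right_mem_Icc.2 hab.le
  let S : (ℝ → ℝ) → ℝ → ℝ := dirichletSolution a b
  let affine : ℝ → ℝ → ℝ → ℝ := fun γ₁ γ₂ x => γ₁ + (γ₂ - γ₁) / (b - a) * (x - a)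
  have affine_left : ∀ γ₁ γ₂, affine γ₁ γ₂ a = γ₁ := fun γ₁ γ₂ => by simp [affine]
  have affine_right : ∀ γ₁ γ₂, affine γ₁ γ₂ b = γ₂ := fun γ₁ γ₂ => by
    simp only [affine]; field_simp; ring
  have affine_deriv : ∀ γ₁ γ₂ x, HasDerivAt (affine γ₁ γ₂) ((γ₂ - γ₁) / (b - a)) x :=
    fun γ₁ γ₂ x => ((((hasDerivAt_id x).sub_const a).const_mul
      ((γ₂ - γ₁) / (b - a))).const_add γ₁).congr_deriv (mul_one _)
  have affine_cont : ∀ γ₁ γ₂, Continuous (affine γ₁ γ₂) := fun γ₁ γ₂ => by fun_prop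
  -- Extend `f` to the plane and absorb the boundary data into it.
  let p : ℝ → ℝ := fun x => affine α₁ α₂ x - S (affine β₁ β₂) x
  obtain ⟨v, hv⟩ := exists_hasDerivAt_dirichletSolution hab (affine_cont β₁ β₂)
  have hS_cont : ∀ c : ℝ → ℝ, Continuous c → Continuous (S c) := fun c hc => by
    obtain ⟨v, hv⟩ := exists_hasDerivAt_dirichletSolution hab hc
    exact continuous_iff_continuousAt.2 fun x => (hv x).1.continuousAt
  have hp : Continuous p := (affine_cont α₁ α₂).sub (hS_cont _ (affine_cont β₁ β₂))
  let f₁ : ℝ → ℝ → ℝ := fun x y => f (projIcc a b hab.le x) (p x + y)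
  have hf₁ : Continuous fun q : ℝ × ℝ => f₁ q.1 q.2 :=
    hf_cont.comp_continuous
      (f := fun q : ℝ × ℝ => ((projIcc a b hab.le q.1 : ℝ), p q.1 + q.2))
      (((continuous_subtype_val.comp continuous_projIcc).comp continuous_fst).prodMk
        (by fun_prop)) fun q => ⟨(projIcc a b hab.le q.1).2, mem_univ _⟩
  have hf₁' : ∀ x, Antitone (f₁ x) := fun x y₁ y₂ hy =>
    hf_mono _ (projIcc a b hab.le x).2 _ _ (by simpa using hy)
  obtain ⟨W, hWc, hW⟩ := exists_eq_integral_integral_of_antitone hab.le hf₁ hf₁'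
    (continuous_dirichletGreen a b)
  let c : ℝ → ℝ := fun x => f₁ x (W x)
  have hc : Continuous c :=
    hf₁.comp (g := fun q : ℝ × ℝ => f₁ q.1 q.2) (f := fun x => (x, W x)) (by fun_prop)
  have hWS : ∀ y ∈ Icc a b, W y = S (S c) y := by
    intro y hy
    rw [hW]
    refine Eq.trans ?_ (integral_dirichletGreen_mul hy (hS_cont c hc))
    refine intervalIntegral.integral_congr fun s hs => ?_
    rw [uIcc_of_le hab.le] at hs
    simp only [S, ← integral_dirichletGreen_mul hs hc, dirichletGreen_comm a b _ s]
    rfl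
  let w : ℝ → ℝ := fun x => p x + S (S c) x
  obtain ⟨v₁, hv₁⟩ := exists_hasDerivAt_dirichletSolution hab hc
  obtain ⟨v₂, hv₂⟩ := exists_hasDerivAt_dirichletSolution hab (hS_cont c hc)
  obtain ⟨hw, hw₂, hw₄⟩ := contDiff_four_of_hasDerivAt (w₀ := w)
    (w₁ := fun x => (α₂ - α₁) / (b - a) - v x + v₂ x) (w₂ := fun x => affine β₁ β₂ x - S c x)
    (w₃ := fun x => (β₂ - β₁) / (b - a) - v₁ x) (w₄ := c)
    (fun x => ((affine_deriv α₁ α₂ x).sub (hv x).1).add (hv₂ x).1)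
    (fun x => (((hv x).2.const_sub _).add (hv₂ x).2).congr_deriv (by ring))
    (fun x => (affine_deriv β₁ β₂ x).sub (hv₁ x).1)
    (fun x => ((hv₁ x).2.const_sub _).congr_deriv (by ring)) hc
  have hwithin : ∀ n : ℕ, (n : WithTop ℕ∞) ≤ 4 → ∀ x ∈ Icc a b,
      iteratedDerivWithin n w (Icc a b) x = iteratedDeriv n w x := fun n hn x hx =>
    iteratedDerivWithin_eq_iteratedDeriv hu (hw.of_le hn).contDiffAt hx
  have hsol : ContDiffOn ℝ 4 w (Icc a b) ∧
      (∀ x ∈ Icc a b, iteratedDerivWithin 4 w (Icc a b) x = f x (w x)) ∧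
      w a = α₁ ∧ w b = α₂ ∧
      iteratedDerivWithin 2 w (Icc a b) a = β₁ ∧ iteratedDerivWithin 2 w (Icc a b) b = β₂ := by
    refine ⟨hw.contDiffOn, fun x hx => ?_, ?_, ?_, ?_, ?_⟩
    · rw [hwithin 4 (by norm_num) x hx, hw₄]
      simp only [c, f₁, w, projIcc_of_mem hab.le hx, hWS x hx]
    · simp [w, p, S, dirichletSolution_left, affine_left]
    · simp [w, p, S, dirichletSolution_right, affine_right]
    · rw [hwithin 2 (by norm_num) a haI, hw₂]
      simp [S, dirichletSolution_left, affine_left]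
    · rw [hwithin 2 (by norm_num) b hbI, hw₂]
      simp [S, dirichletSolution_right, affine_right]
  refine ⟨w, hsol, ?_⟩
  obtain ⟨hw_diff, hw_eq, hwa, hwb, hwa', hwb'⟩ := hsol
  rintro w' ⟨hw'_diff, hw'_eq, hw'a, hw'b, hw'a', hw'b'⟩
  let d : ℕ → ℝ → ℝ := fun n x =>
    iteratedDerivWithin n w' (Icc a b) x - iteratedDerivWithin n w (Icc a b) x
  have hd_cont : ∀ n : ℕ, (n : WithTop ℕ∞) ≤ 4 → ContinuousOn (d n) (Icc a b) := fun n hn =>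
    (hw'_diff.continuousOn_iteratedDerivWithin hn hu).sub
      (hw_diff.continuousOn_iteratedDerivWithin hn hu)
  have hd_deriv : ∀ n : ℕ, n < 4 → ∀ x ∈ Ioo a b, HasDerivAt (d n) (d (n + 1) x) x :=
    fun n hn x hx => (hw'_diff.hasDerivAt_iteratedDerivWithin_Icc hn hx).sub
      (hw_diff.hasDerivAt_iteratedDerivWithin_Icc hn hx)
  have hzero := eqOn_zero_of_mul_fourth_deriv_nonpos
    (hd_cont 0 (by norm_num)) (hd_cont 1 (by norm_num)) (hd_cont 2 (by norm_num))
    (hd_cont 3 (by norm_num)) (hd_deriv 0 (by norm_num)) (hd_deriv 1 (by norm_num))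
    (hd_deriv 2 (by norm_num)) (hd_deriv 3 (by norm_num)) ?_ (by simp [d, hwa, hw'a])
    (by simp [d, hwb, hw'b]) (by simp [d, hwa', hw'a']) (by simp [d, hwb', hw'b'])
  · intro x hx
    simpa [d, sub_eq_zero] using hzero x hx
  · intro x hx
    have hx' := Ioo_subset_Icc_self hx
    simp only [d, iteratedDerivWithin_zero, Nat.reduceAdd]
    rw [hw'_eq x hx', hw_eq x hx']
    rcases le_total (w x) (w' x) with h | h
    · exact mul_nonpos_of_nonneg_of_nonpos (sub_nonneg.2 h) (sub_nonpos.2 (hf_mono x hx' _ _ h))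
    · exact mul_nonpos_of_nonpos_of_nonneg (sub_nonpos.2 h) (sub_nonneg.2 (hf_mono x hx' _ _ h))
end

section
/- Let a < b, let f : [a,b] × ℝ → ℝ be continuous, bounded above by M ∈ ℝ, and nonincreasing in its second argument, and set f_M(x,y) = f(x,y) − M. With G, w̄_M, and the operator 𝓛[v](x) = w̄_M(x) + ∫ₐᵇ G(x,s) f_M(s,v(s)) ds as above, set η = sup_{x∈[a,b]} |w̄_M'(x)| + L_G · sup_{x∈[a,b]} |f_M(x, w̄_M(x))| · (b−a), where L_G = 3 · sup_{s∈[a,b]} ∫ₐᵇ |G̃(t,s)| dt. Then for every continuous q : [a,b] → ℝ with 𝓛[w̄_M](x) ≤ q(x) ≤ w̄_M(x) for all x ∈ [a,b], the function 𝓛[q] is Lipschitz continuous on [a,b] with Lipschitz constant at most η, i.e., |𝓛[q](y) − 𝓛[q](x)| ≤ η|y−x| for all x, y ∈ [a,b]. -/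
open Set intervalIntegral

/-- The Green's function of the second-order BVP `y'' = h`, `y a = y b = 0`. -/
noncomputable def Gt (a b x s : ℝ) : ℝ :=
  if s ≤ x then -((b - x) * (s - a)) / (b - a) else -((b - s) * (x - a)) / (b - a)

/-- The Green's function `G(x,s) = ∫ₐᵇ G̃(x,t) G̃(t,s) dt` of the fourth-order BVP. -/
noncomputable def Gker (a b x s : ℝ) : ℝ := ∫ t in a..b, Gt a b x t * Gt a b t s

/-- The fourth-degree polynomial `w̄_M` satisfying `w̄_M⁗ = M`, `w̄_M a = α₁`, `w̄_M b = α₂`,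
`w̄_M'' a = β₁`, `w̄_M'' b = β₂`. -/
noncomputable def wbarM (a b α₁ α₂ β₁ β₂ M x : ℝ) : ℝ :=
  α₁ + ((α₂ - α₁) / (b - a) - (β₂ + 2 * β₁) * (b - a) / 6 + M * (b - a) ^ 3 / 24) * (x - a)
    + β₁ / 2 * (x - a) ^ 2
    + ((β₂ - β₁) / (6 * (b - a)) - M * (b - a) / 12) * (x - a) ^ 3
    + M / 24 * (x - a) ^ 4

/-- The operator `𝓛[v] x = w̄_M x + ∫ₐᵇ G(x,s) f_M(s, v s) ds`, where `f_M = f - M`. -/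
noncomputable def Lop (a b α₁ α₂ β₁ β₂ M : ℝ) (f : ℝ → ℝ → ℝ) (v : ℝ → ℝ) (x : ℝ) : ℝ :=
  wbarM a b α₁ α₂ β₁ β₂ M x + ∫ s in a..b, Gker a b x s * (f s (v s) - M)

/-- The Lipschitz constant `L_G = 3 ⨆_{s ∈ [a,b]} ∫ₐᵇ |G̃(t,s)| dt` of `G`. -/
noncomputable def LG (a b : ℝ) : ℝ :=
  3 * sSup ((fun s => ∫ t in a..b, |Gt a b t s|) '' Set.Icc a b)

theorem Gt_eq_max {a b : ℝ} (hab : a < b) (x s : ℝ) :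
    Gt a b x s = max (x - s) 0 - (b - s) / (b - a) * (x - a) := by
  have h : b - a ≠ 0 := (sub_pos.2 hab).ne'
  unfold Gt
  split_ifs with hs
  · rw [max_eq_left (sub_nonneg.2 hs)]
    field_simp
    ring
  · rw [max_eq_right (by linarith)]
    ring

theorem continuous_Gt {a b : ℝ} (hab : a < b) :
    Continuous fun p : ℝ × ℝ => Gt a b p.1 p.2 := by
  simp only [Gt_eq_max hab]
  fun_prop

theorem continuous_Gker {a b : ℝ} (hab : a < b) (x : ℝ) : Continuous (Gker a b x) := by
  have hG := continuous_Gt hab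
  unfold Gker
  refine continuous_parametric_intervalIntegral_of_continuous'
    (f := fun s t => Gt a b x t * Gt a b t s) ?_ a b
  exact (hG.comp (continuous_const.prodMk continuous_snd)).mul
    (hG.comp (continuous_snd.prodMk continuous_fst))

theorem abs_Gt_sub_le {a b t : ℝ} (hab : a < b) (ht : t ∈ Set.Icc a b) (x y : ℝ) :
    |Gt a b y t - Gt a b x t| ≤ 2 * |y - x| := by
  have hba : 0 < b - a := sub_pos.2 hab
  have hmax : |max (y - t) 0 - max (x - t) 0| ≤ |y - x| := by
    simpa using abs_max_sub_max_le_abs (y - t) (x - t) 0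
  have hc : |(b - t) / (b - a)| ≤ 1 := by
    rw [abs_of_nonneg (div_nonneg (sub_nonneg.2 ht.2) hba.le), div_le_one hba]
    linarith [ht.1]
  have hlin : |(b - t) / (b - a) * (y - x)| ≤ |y - x| := by
    rw [abs_mul]
    exact mul_le_of_le_one_left (abs_nonneg _) hc
  rw [Gt_eq_max hab, Gt_eq_max hab]
  calc _ = |(max (y - t) 0 - max (x - t) 0) - (b - t) / (b - a) * (y - x)| := by
        congr 1; ring
    _ ≤ _ := abs_sub _ _
    _ ≤ _ := by linarith

theorem integral_abs_Gt_nonneg {a b : ℝ} (hab : a < b) (s : ℝ) :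
    0 ≤ ∫ t in a..b, |Gt a b t s| :=
  integral_nonneg hab.le fun _ _ => abs_nonneg _

theorem integral_abs_Gt_le_sSup {a b s : ℝ} (hab : a < b) (hs : s ∈ Set.Icc a b) :
    ∫ t in a..b, |Gt a b t s| ≤
      sSup ((fun s => ∫ t in a..b, |Gt a b t s|) '' Set.Icc a b) := by
  have hcont : Continuous fun s => ∫ t in a..b, |Gt a b t s| := by
    refine continuous_parametric_intervalIntegral_of_continuous'
      (f := fun s t => |Gt a b t s|) ?_ a b
    exact ((continuous_Gt hab).comp (continuous_snd.prodMk continuous_fst)).abs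
  exact le_csSup (isCompact_Icc.bddAbove_image hcont.continuousOn) (mem_image_of_mem _ hs)

theorem LG_nonneg {a b : ℝ} (hab : a < b) : 0 ≤ LG a b :=
  mul_nonneg (by norm_num) ((integral_abs_Gt_nonneg hab a).trans
    (integral_abs_Gt_le_sSup hab (left_mem_Icc.2 hab.le)))

theorem abs_Gker_sub_le {a b s : ℝ} (hab : a < b) (hs : s ∈ Set.Icc a b) (x y : ℝ) :
    |Gker a b y s - Gker a b x s| ≤ LG a b * |y - x| := by
  have hG := continuous_Gt hab
  have hl : Continuous fun t => Gt a b t s := hG.comp (continuous_id.prodMk continuous_const)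
  have hr (z : ℝ) : Continuous fun t => Gt a b z t :=
    hG.comp (continuous_const.prodMk continuous_id)
  have hm (z : ℝ) : Continuous fun t => Gt a b z t * Gt a b t s := (hr z).mul hl
  unfold Gker
  rw [← integral_sub ((hm y).intervalIntegrable a b) ((hm x).intervalIntegrable a b)]
  calc _ ≤ ∫ t in a..b, |Gt a b y t * Gt a b t s - Gt a b x t * Gt a b t s| :=
        abs_integral_le_integral_abs hab.le
    _ ≤ ∫ t in a..b, 2 * |y - x| * |Gt a b t s| := by
        refine integral_mono_on hab.le
          (((hm y).sub (hm x)).abs.intervalIntegrable a b)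
          ((continuous_const.mul hl.abs).intervalIntegrable a b) fun t ht => ?_
        rw [← sub_mul, abs_mul]
        exact mul_le_mul_of_nonneg_right (abs_Gt_sub_le hab ht x y) (abs_nonneg _)
    _ = 2 * |y - x| * ∫ t in a..b, |Gt a b t s| := integral_const_mul _ _
    _ ≤ _ := by
        have h := mul_le_mul_of_nonneg_left (integral_abs_Gt_le_sSup hab hs) (abs_nonneg (y - x))
        have h₀ := mul_nonneg (abs_nonneg (y - x)) (integral_abs_Gt_nonneg hab s)
        unfold LG
        linarith

theorem contDiff_wbarM (a b α₁ α₂ β₁ β₂ M : ℝ) :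
    ContDiff ℝ 1 (wbarM a b α₁ α₂ β₁ β₂ M) := by
  unfold wbarM
  fun_prop

theorem abs_wbarM_sub_le (a b α₁ α₂ β₁ β₂ M : ℝ) {x y : ℝ}
    (hx : x ∈ Set.Icc a b) (hy : y ∈ Set.Icc a b) :
    |wbarM a b α₁ α₂ β₁ β₂ M y - wbarM a b α₁ α₂ β₁ β₂ M x| ≤
      sSup ((fun x => |deriv (wbarM a b α₁ α₂ β₁ β₂ M) x|) '' Set.Icc a b) * |y - x| := by
  have hw := contDiff_wbarM a b α₁ α₂ β₁ β₂ M
  refine (convex_Icc a b).norm_image_sub_le_of_norm_deriv_le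
    (fun z _ => (hw.differentiable one_ne_zero).differentiableAt) (fun z hz => ?_) hx hy
  exact le_csSup
    (isCompact_Icc.bddAbove_image (hw.continuous_deriv le_rfl).abs.continuousOn)
    (mem_image_of_mem _ hz)

theorem abs_integral_Gker_mul_sub_le {a b K : ℝ} (hab : a < b) {g : ℝ → ℝ}
    (hg : ContinuousOn g (Set.Icc a b)) (hK : ∀ s ∈ Set.Icc a b, |g s| ≤ K) (x y : ℝ) :
    |(∫ s in a..b, Gker a b y s * g s) - ∫ s in a..b, Gker a b x s * g s| ≤
      LG a b * K * (b - a) * |y - x| := by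
  have hint (z : ℝ) : IntervalIntegrable (fun s => Gker a b z s * g s) MeasureTheory.volume a b :=
    ((continuous_Gker hab z).continuousOn.mul hg).intervalIntegrable_of_Icc hab.le
  rw [← integral_sub (hint y) (hint x)]
  have h : ∀ s ∈ Set.uIoc a b,
      ‖Gker a b y s * g s - Gker a b x s * g s‖ ≤ LG a b * |y - x| * K := by
    intro s hs
    rw [uIoc_of_le hab.le] at hs
    have hs' := Ioc_subset_Icc_self hs
    rw [Real.norm_eq_abs, ← sub_mul, abs_mul]
    exact mul_le_mul (abs_Gker_sub_le hab hs' x y) (hK s hs') (abs_nonneg _)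
      (mul_nonneg (LG_nonneg hab) (abs_nonneg _))
  have := norm_integral_le_of_norm_le_const h
  rw [Real.norm_eq_abs, abs_of_pos (sub_pos.2 hab)] at this
  linarith

/-- With `η = sup_{[a,b]} |w̄_M'| + L_G · sup_{[a,b]} |f_M(x, w̄_M x)| · (b-a)`, for any
continuous `q` with `𝓛[w̄_M] ≤ q ≤ w̄_M` on `[a,b]`, the function `𝓛[q]` is Lipschitz
with constant `η` on `[a,b]`. -/
theorem Lop_lipschitz (a b : ℝ) (hab : a < b) (α₁ α₂ β₁ β₂ M : ℝ)
    (f : ℝ → ℝ → ℝ)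
    (hf_cont : ContinuousOn (fun p : ℝ × ℝ => f p.1 p.2) (Set.Icc a b ×ˢ Set.univ))
    (hf_bdd : ∀ x ∈ Set.Icc a b, ∀ y : ℝ, f x y ≤ M)
    (hf_mono : ∀ x ∈ Set.Icc a b, ∀ y₁ y₂ : ℝ, y₂ ≤ y₁ → f x y₁ ≤ f x y₂)
    (η : ℝ)
    (hη : η = sSup ((fun x => |deriv (wbarM a b α₁ α₂ β₁ β₂ M) x|) '' Set.Icc a b)
      + LG a b * sSup ((fun x => |f x (wbarM a b α₁ α₂ β₁ β₂ M x) - M|) '' Set.Icc a b)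
        * (b - a))
    (q : ℝ → ℝ) (hq : ContinuousOn q (Set.Icc a b))
    (hq_between : ∀ x ∈ Set.Icc a b,
      Lop a b α₁ α₂ β₁ β₂ M f (wbarM a b α₁ α₂ β₁ β₂ M) x ≤ q x ∧
      q x ≤ wbarM a b α₁ α₂ β₁ β₂ M x) :
    ∀ x ∈ Set.Icc a b, ∀ y ∈ Set.Icc a b,
      |Lop a b α₁ α₂ β₁ β₂ M f q y - Lop a b α₁ α₂ β₁ β₂ M f q x| ≤ η * |y - x| := by
  intro x hx y hy
  have hcomp {v : ℝ → ℝ} (hv : ContinuousOn v (Set.Icc a b)) :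
      ContinuousOn (fun s => f s (v s) - M) (Set.Icc a b) :=
    (hf_cont.comp (continuousOn_id.prodMk hv) fun s hs => ⟨hs, mem_univ _⟩).sub
      continuousOn_const
  have hw := (contDiff_wbarM a b α₁ α₂ β₁ β₂ M).continuous.continuousOn (s := Set.Icc a b)
  have hK : ∀ s ∈ Set.Icc a b, |f s (q s) - M| ≤
      sSup ((fun x => |f x (wbarM a b α₁ α₂ β₁ β₂ M x) - M|) '' Set.Icc a b) := by
    intro s hs
    refine le_trans ?_ (le_csSup (isCompact_Icc.bddAbove_image (hcomp hw).abs)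
      (mem_image_of_mem _ hs))
    rw [abs_of_nonpos (sub_nonpos.2 (hf_bdd s hs _)),
      abs_of_nonpos (sub_nonpos.2 (hf_bdd s hs _))]
    linarith [hf_mono s hs _ _ (hq_between s hs).2]
  have h₁ := abs_wbarM_sub_le a b α₁ α₂ β₁ β₂ M hx hy
  have h₂ := abs_integral_Gker_mul_sub_le hab (hcomp hq) hK x y
  unfold Lop
  rw [add_sub_add_comm, hη, add_mul]
  exact (abs_add_le _ _).trans (add_le_add h₁ h₂)
end

section
/- Let a < b, N ∈ ℕ with N ≥ 2, h = (b−a)/(N+1), K ≥ 0, and let 𝓐 be the N×N symmetric positive definite pentadiagonal matrix with diagonal (5, 6, …, 6, 5), first off-diagonals −4, and second off-diagonals 1. Then the matrix 𝓐 + (h⁴K/2) I is invertible and the spectral norm of (h⁴K/2)(𝓐 + (h⁴K/2) I)⁻¹ satisfies ‖(h⁴K/2)(𝓐 + (h⁴K/2) I)⁻¹‖₂ ≤ (b−a)⁴K / ((b−a)⁴K + 32) < 1. Consequently, for any 𝓑̄, 𝓖 ∈ ℝᴺ, the map 𝓣(X) = (𝓐 + (h⁴K/2) I)⁻¹(𝓑̄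 + (h⁴K/2) 𝓖) − (h⁴K/2)(𝓐 + (h⁴K/2) I)⁻¹ |X − 𝓖| is a contraction on ℝᴺ with respect to the Euclidean norm, with contraction constant (b−a)⁴K / ((b−a)⁴K + 32). -/
open Matrix

/-- The `N × N` pentadiagonal finite-difference matrix `𝓐` with diagonal `(5, 6, …, 6, 5)`,
first off-diagonals `−4`, and second off-diagonals `1`. -/
def penta (N : ℕ) : Matrix (Fin N) (Fin N) ℝ :=
  Matrix.of fun i j =>
    if i = j then (if i.val = 0 ∨ i.val = N - 1 then 5 else 6)
    else if i.val + 1 = j.val ∨ j.val + 1 = i.val then -4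
    else if i.val + 2 = j.val ∨ j.val + 2 = i.val then 1
    else 0

/-- Discrete Poincaré inequality for sequences vanishing at both ends. -/
theorem four_mul_sum_sq_le_sum_diff_sq (f : ℕ → ℝ) (M : ℕ) (h0 : f 0 = 0) (hM : f M = 0) :
    4 * ∑ i ∈ Finset.range M, f i ^ 2 ≤
      (M : ℝ) ^ 2 * ∑ i ∈ Finset.range M, (f (i + 1) - f i) ^ 2 := by
  rcases Nat.eq_zero_or_pos M with rfl | hpos
  · simp
  set S := ∑ i ∈ Finset.range M, (f (i + 1) - f i) ^ 2 with hS
  have hMpos : (0 : ℝ) < M := by exact_mod_cast hpos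
  have hS0 : 0 ≤ S := Finset.sum_nonneg fun _ _ => sq_nonneg _
  have key : ∀ i ∈ Finset.range M, 4 * f i ^ 2 ≤ M * S := by
    intro i hi
    have hiM : i ≤ M := (Finset.mem_range.1 hi).le
    have hl : f i ^ 2 ≤ i * ∑ j ∈ Finset.range i, (f (j + 1) - f j) ^ 2 := by
      have := sq_sum_le_card_mul_sum_sq (s := Finset.range i) (f := fun j => f (j + 1) - f j)
      rw [Finset.sum_range_sub, h0, sub_zero, Finset.card_range] at this
      exact this
    have hr : f i ^ 2 ≤ (M - i) * ∑ j ∈ Finset.Ico i M, (f (j + 1) - f j) ^ 2 := by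
      have := sq_sum_le_card_mul_sum_sq (s := Finset.Ico i M) (f := fun j => f (j + 1) - f j)
      rw [Finset.sum_Ico_sub _ hiM, hM, Nat.card_Ico, Nat.cast_sub hiM] at this
      simpa using this
    have hsum := Finset.sum_range_add_sum_Ico (fun j => (f (j + 1) - f j) ^ 2) hiM
    rw [← hS] at hsum
    have hi0 : (0 : ℝ) ≤ i := Nat.cast_nonneg i
    have hMi : (0 : ℝ) ≤ M - i := sub_nonneg.2 (by exact_mod_cast hiM)
    have hprod : (M : ℝ) * f i ^ 2 ≤ i * (M - i) * S := by
      rw [← hsum]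
      linarith [mul_le_mul_of_nonneg_left hl hMi, mul_le_mul_of_nonneg_left hr hi0]
    have hquarter : 4 * ((i : ℝ) * (M - i)) * S ≤ M ^ 2 * S :=
      mul_le_mul_of_nonneg_right (by nlinarith [sq_nonneg ((M : ℝ) - 2 * i)]) hS0
    refine le_of_mul_le_mul_left ?_ hMpos
    linarith
  calc 4 * ∑ i ∈ Finset.range M, f i ^ 2 = ∑ i ∈ Finset.range M, 4 * f i ^ 2 := by
        rw [Finset.mul_sum]
    _ ≤ ∑ _i ∈ Finset.range M, M * S := Finset.sum_le_sum key
    _ = (M : ℝ) ^ 2 * S := by simp; ring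

/-- Summation by parts for the discrete Dirichlet energy. -/
theorem sum_diff_sq_eq_sum_mul_secondDiff (f : ℕ → ℝ) (N : ℕ) (h0 : f 0 = 0)
    (hN : f (N + 1) = 0) :
    ∑ i ∈ Finset.range (N + 1), (f (i + 1) - f i) ^ 2 =
      ∑ i ∈ Finset.range N, f (i + 1) * (2 * f (i + 1) - f i - f (i + 2)) := by
  have key : ∀ n : ℕ, ∑ i ∈ Finset.range (n + 1), (f (i + 1) - f i) ^ 2 =
      ∑ i ∈ Finset.range n, f (i + 1) * (2 * f (i + 1) - f i - f (i + 2)) +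
        f (n + 1) * (f (n + 1) - f n) := by
    intro n
    induction n with
    | zero => simp [h0]; ring
    | succ n ih => rw [Finset.sum_range_succ, ih, Finset.sum_range_succ]; ring
  rw [key, hN, zero_mul, add_zero]

/-- The discrete Dirichlet Laplacian is symmetric. -/
theorem sum_mul_secondDiff_comm (f g : ℕ → ℝ) (N : ℕ) (hf0 : f 0 = 0) (hg0 : g 0 = 0)
    (hf : f (N + 1) = 0) (hg : g (N + 1) = 0) :
    ∑ i ∈ Finset.range N, f (i + 1) * (2 * g (i + 1) - g i - g (i + 2)) =
      ∑ i ∈ Finset.range N, g (i + 1) * (2 * f (i + 1) - f i - f (i + 2)) := by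
  have key : ∀ n : ℕ, ∑ i ∈ Finset.range n, f (i + 1) * (2 * g (i + 1) - g i - g (i + 2)) =
      ∑ i ∈ Finset.range n, g (i + 1) * (2 * f (i + 1) - f i - f (i + 2)) +
        (g n * f (n + 1) - f n * g (n + 1)) := by
    intro n
    induction n with
    | zero => simp [hf0, hg0]
    | succ n ih => rw [Finset.sum_range_succ, ih, Finset.sum_range_succ]; ring
  rw [key, hf, hg]; ring

/-- The extension of `x` by zero, shifted so that `x i` sits at position `i + 1`. -/
def zeroExtend {N : ℕ} (x : Fin N → ℝ) (m : ℕ) : ℝ :=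
  ∑ j : Fin N, if j.val + 1 = m then x j else 0

theorem zeroExtend_succ {N : ℕ} (x : Fin N → ℝ) (i : Fin N) :
    zeroExtend x (i.val + 1) = x i := by
  simp [zeroExtend, Fin.val_inj]

theorem zeroExtend_zero {N : ℕ} (x : Fin N → ℝ) : zeroExtend x 0 = 0 := by
  simp [zeroExtend]

theorem zeroExtend_of_lt {N : ℕ} (x : Fin N → ℝ) {m : ℕ} (hm : N < m) :
    zeroExtend x m = 0 :=
  Finset.sum_eq_zero fun j _ => if_neg (by have := j.isLt; omega)

theorem penta_mulVec_apply {N : ℕ} (hN : 2 ≤ N) (x : Fin N → ℝ) (i : Fin N) :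
    (penta N *ᵥ x) i =
      6 * zeroExtend x (i.val + 1) - 4 * zeroExtend x i.val - 4 * zeroExtend x (i.val + 2)
        + zeroExtend x (i.val - 1) + zeroExtend x (i.val + 3)
        - (if i.val = 0 ∨ i.val = N - 1 then zeroExtend x (i.val + 1) else 0) := by
  have hboundary : (if i.val = 0 ∨ i.val = N - 1 then zeroExtend x (i.val + 1) else 0) =
      ∑ j : Fin N, if i.val = 0 ∨ i.val = N - 1 then
        (if j.val + 1 = i.val + 1 then x j else 0) else 0 := by
    split_ifs <;> simp [zeroExtend]
  rw [hboundary]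
  simp only [zeroExtend, Finset.mul_sum, ← Finset.sum_sub_distrib, ← Finset.sum_add_distrib,
    Matrix.mulVec, dotProduct]
  refine Finset.sum_congr rfl fun j _ => ?_
  have := i.isLt
  have := j.isLt
  simp only [penta, Matrix.of_apply, Fin.ext_iff]
  split_ifs <;> first | omega | ring

/-- The quadratic form of `penta` is the sum of the squared second differences. -/
theorem dotProduct_penta_mulVec {N : ℕ} (hN : 2 ≤ N) (x : Fin N → ℝ) :
    x ⬝ᵥ (penta N *ᵥ x) = ∑ i ∈ Finset.range N,
      (2 * zeroExtend x (i + 1) - zeroExtend x i - zeroExtend x (i + 2)) ^ 2 := by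
  set f := zeroExtend x with hf
  have hf0 : f 0 = 0 := zeroExtend_zero x
  have hfN : f (N + 1) = 0 := zeroExtend_of_lt x (by omega)
  let g : ℕ → ℝ := fun m =>
    if m = 0 ∨ m = N + 1 then 0 else 2 * f m - f (m - 1) - f (m + 1)
  have hg : ∀ i < N, g (i + 1) = 2 * f (i + 1) - f i - f (i + 2) := by
    intro i hi
    simp only [g]
    rw [if_neg (by omega)]
    rfl
  have hA : ∀ i : Fin N, (penta N *ᵥ x) i =
      2 * g (i.val + 1) - g i.val - g (i.val + 2) := by
    intro i
    have hi := i.isLt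
    rw [penta_mulVec_apply hN, ← hf, hg _ hi]
    rcases Nat.eq_zero_or_pos i.val with h0 | h0
    · rw [h0, hg 1 (by omega)]
      simp [g, hf0]
      ring
    · obtain ⟨k, hk⟩ := Nat.exists_eq_add_of_lt h0
      rw [zero_add] at hk
      rw [hk] at hi ⊢
      rw [hg k (by omega)]
      by_cases hlast : k + 1 = N - 1
      · have h2 : f (k + 1 + 2) = 0 := zeroExtend_of_lt x (by omega)
        have h3 : f (k + 1 + 3) = 0 := zeroExtend_of_lt x (by omega)
        have hgN : g (k + 1 + 2) = 0 := if_pos (by omega)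
        rw [if_pos (Or.inr hlast), h2, h3, hgN]
        simp only [Nat.add_sub_cancel]
        ring
      · rw [if_neg (by omega), hg (k + 1 + 1) (by omega)]
        simp only [Nat.add_sub_cancel]
        ring
  calc x ⬝ᵥ (penta N *ᵥ x)
      = ∑ i : Fin N, f (i.val + 1) * (2 * g (i.val + 1) - g i.val - g (i.val + 2)) :=
        Finset.sum_congr rfl fun i _ => by rw [hA, hf, zeroExtend_succ]
    _ = ∑ i ∈ Finset.range N, f (i + 1) * (2 * g (i + 1) - g i - g (i + 2)) :=
        Fin.sum_univ_eq_sum_range (fun i => f (i + 1) * (2 * g (i + 1) - g i - g (i + 2))) N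
    _ = ∑ i ∈ Finset.range N, g (i + 1) * (2 * f (i + 1) - f i - f (i + 2)) :=
        sum_mul_secondDiff_comm f g N hf0 (if_pos (Or.inl rfl)) hfN (if_pos (Or.inr rfl))
    _ = _ := Finset.sum_congr rfl fun i hi => by
        rw [hg i (Finset.mem_range.1 hi), sq]

/-- Lower bound for the smallest eigenvalue of `penta`. -/
theorem le_dotProduct_penta_mulVec {N : ℕ} (hN : 2 ≤ N) (x : Fin N → ℝ) :
    16 / ((N : ℝ) + 1) ^ 4 * (x ⬝ᵥ x) ≤ x ⬝ᵥ (penta N *ᵥ x) := by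
  set f := zeroExtend x with hf
  have hf0 : f 0 = 0 := zeroExtend_zero x
  have hfN : f (N + 1) = 0 := zeroExtend_of_lt x (by omega)
  have hx : x ⬝ᵥ x = ∑ i ∈ Finset.range N, f (i + 1) ^ 2 := by
    rw [← Fin.sum_univ_eq_sum_range (fun i => f (i + 1) ^ 2) N]
    exact Finset.sum_congr rfl fun i _ => by rw [hf, zeroExtend_succ, sq]
  have hP := four_mul_sum_sq_le_sum_diff_sq f (N + 1) hf0 hfN
  rw [sum_diff_sq_eq_sum_mul_secondDiff f N hf0 hfN, Finset.sum_range_succ', hf0] at hP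
  rw [dotProduct_penta_mulVec hN, ← hf, hx]
  set g : ℕ → ℝ := fun i => 2 * f (i + 1) - f i - f (i + 2) with hg
  set F := ∑ i ∈ Finset.range N, f (i + 1) ^ 2
  set E := ∑ i ∈ Finset.range N, f (i + 1) * (2 * f (i + 1) - f i - f (i + 2))
  set Q := ∑ i ∈ Finset.range N, (2 * f (i + 1) - f i - f (i + 2)) ^ 2
  have hM : (0 : ℝ) < (N : ℝ) + 1 := by positivity
  set μ : ℝ := 4 / ((N : ℝ) + 1) ^ 2 with hμ
  have hμ0 : 0 ≤ μ := by positivity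
  have hE : μ * F ≤ E := by
    rw [hμ, div_mul_eq_mul_div, div_le_iff₀ (by positivity)]
    push_cast at hP
    linarith
  have hsq : 0 ≤ Q - 2 * μ * E + μ ^ 2 * F := by
    have h0 : 0 ≤ ∑ i ∈ Finset.range N, (g i - μ * f (i + 1)) ^ 2 :=
      Finset.sum_nonneg fun _ _ => sq_nonneg _
    convert h0 using 1
    simp only [Q, E, F, Finset.mul_sum, ← Finset.sum_sub_distrib, ← Finset.sum_add_distrib]
    exact Finset.sum_congr rfl fun i _ => by simp only [hg]; ring
  have hμsq : 16 / ((N : ℝ) + 1) ^ 4 = μ ^ 2 := by rw [hμ, div_pow]; ring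
  rw [hμsq]
  nlinarith [mul_le_mul_of_nonneg_left hE hμ0]

/-- A matrix whose quadratic form is bounded below by `m > 0` is invertible. -/
theorem isUnit_of_coercive {n : Type*} [Fintype n] [DecidableEq n] {P : Matrix n n ℝ} {m : ℝ}
    (hm : 0 < m) (hP : ∀ x, m * (x ⬝ᵥ x) ≤ x ⬝ᵥ (P *ᵥ x)) : IsUnit P := by
  rw [← Matrix.mulVec_injective_iff_isUnit]
  refine (injective_iff_map_eq_zero P.mulVecLin).2 fun x hx => ?_
  have h := hP x
  rw [show P *ᵥ x = 0 from hx, dotProduct_zero] at h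
  have h0 : 0 ≤ x ⬝ᵥ x := Finset.sum_nonneg fun i _ => mul_self_nonneg (x i)
  exact dotProduct_self_eq_zero.1 (by nlinarith)

/-- A matrix whose quadratic form is bounded below by `m > 0` has an inverse of norm at most
`m⁻¹`. -/
theorem norm_toEuclideanCLM_inv_le_of_coercive {n : Type*} [Fintype n] [DecidableEq n]
    {P : Matrix n n ℝ} {m : ℝ} (hm : 0 < m) (hP : ∀ x, m * (x ⬝ᵥ x) ≤ x ⬝ᵥ (P *ᵥ x)) :
    ‖Matrix.toEuclideanCLM (𝕜 := ℝ) (n := n) P⁻¹‖ ≤ m⁻¹ := by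
  have hU : IsUnit P.det := (Matrix.isUnit_iff_isUnit_det P).1 (isUnit_of_coercive hm hP)
  refine ContinuousLinearMap.opNorm_le_bound _ (by positivity) fun y => ?_
  set x := Matrix.toEuclideanCLM (𝕜 := ℝ) (n := n) P⁻¹ y with hx
  have hPx : P *ᵥ x.ofLp = y.ofLp := by
    rw [hx, Matrix.ofLp_toEuclideanCLM, Matrix.mulVec_mulVec, Matrix.mul_nonsing_inv _ hU,
      Matrix.one_mulVec]
  have h := hP x.ofLp
  have hinner : ∀ u v : EuclideanSpace ℝ n, u.ofLp ⬝ᵥ v.ofLp = inner ℝ u v := fun u v => by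
    rw [EuclideanSpace.inner_eq_star_dotProduct, star_trivial, dotProduct_comm]
  rw [hPx, hinner, hinner, real_inner_self_eq_norm_sq] at h
  have hcs := real_inner_le_norm x y
  rw [inv_mul_eq_div, le_div_iff₀ hm]
  rcases (norm_nonneg x).eq_or_lt with h0 | h0
  · rw [← h0, zero_mul]
    exact norm_nonneg y
  · refine le_of_mul_le_mul_left ?_ h0
    linarith

/-- With `h = (b-a)/(N+1)`, the matrix `𝓐 + (h⁴K/2)I` is invertible, the spectral norm of
`(h⁴K/2)(𝓐 + (h⁴K/2)I)⁻¹` is at most `(b-a)⁴K/((b-a)⁴K+32) < 1`, and the map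
`𝓣(X) = (𝓐 + (h⁴K/2)I)⁻¹(𝓑̄ + (h⁴K/2)𝓖) − (h⁴K/2)(𝓐 + (h⁴K/2)I)⁻¹|X−𝓖|` is a contraction
on Euclidean space with this constant. -/
theorem contraction_map (a b : ℝ) (hab : a < b) (N : ℕ) (hN : 2 ≤ N) (K : ℝ) (hK : 0 ≤ K)
    (B G : EuclideanSpace ℝ (Fin N)) (h : ℝ) (hh : h = (b - a) / (N + 1)) :
    IsUnit (penta N + (h ^ 4 * K / 2) • (1 : Matrix (Fin N) (Fin N) ℝ)) ∧
    ‖Matrix.toEuclideanCLM (𝕜 := ℝ) (n := Fin N)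
        ((h ^ 4 * K / 2) • (penta N + (h ^ 4 * K / 2) • (1 : Matrix (Fin N) (Fin N) ℝ))⁻¹)‖ ≤
      (b - a) ^ 4 * K / ((b - a) ^ 4 * K + 32) ∧
    (b - a) ^ 4 * K / ((b - a) ^ 4 * K + 32) < 1 ∧
    LipschitzWith (Real.toNNReal ((b - a) ^ 4 * K / ((b - a) ^ 4 * K + 32)))
      (fun X : EuclideanSpace ℝ (Fin N) =>
        Matrix.toEuclideanCLM (𝕜 := ℝ) (n := Fin N)
            ((penta N + (h ^ 4 * K / 2) • (1 : Matrix (Fin N) (Fin N) ℝ))⁻¹)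
            (B + (h ^ 4 * K / 2) • G) -
          (h ^ 4 * K / 2) •
            Matrix.toEuclideanCLM (𝕜 := ℝ) (n := Fin N)
              ((penta N + (h ^ 4 * K / 2) • (1 : Matrix (Fin N) (Fin N) ℝ))⁻¹)
              ((EuclideanSpace.equiv (Fin N) ℝ).symm (fun i => |X i - G i|))) := by
  set c := h ^ 4 * K / 2 with hc
  set P := penta N + c • (1 : Matrix (Fin N) (Fin N) ℝ) with hPdef
  set L := (b - a) ^ 4 * K / ((b - a) ^ 4 * K + 32) with hL
  have hc0 : 0 ≤ c := by positivity
  have hba : 0 ≤ (b - a) ^ 4 * K := by positivity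
  have hM : (0 : ℝ) < (N : ℝ) + 1 := by positivity
  set m : ℝ := 16 / ((N : ℝ) + 1) ^ 4 + c with hm
  have hm0 : 0 < m := by positivity
  have hP : ∀ x, m * (x ⬝ᵥ x) ≤ x ⬝ᵥ (P *ᵥ x) := by
    intro x
    have := le_dotProduct_penta_mulVec hN x
    rw [hPdef, Matrix.add_mulVec, Matrix.smul_mulVec, Matrix.one_mulVec, dotProduct_add,
      dotProduct_smul, smul_eq_mul, hm]
    linarith
  have hcm : c * m⁻¹ = L := by
    rw [hm, hL, hc, hh, div_pow]
    field_simp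
    ring
  have hnorm : ‖Matrix.toEuclideanCLM (𝕜 := ℝ) (n := Fin N) (c • P⁻¹)‖ ≤ L := by
    rw [map_smul, norm_smul, Real.norm_of_nonneg hc0, ← hcm]
    exact mul_le_mul_of_nonneg_left (norm_toEuclideanCLM_inv_le_of_coercive hm0 hP) hc0
  refine ⟨isUnit_of_coercive hm0 hP, hnorm, ?_, ?_⟩
  · rw [hL, div_lt_one (by positivity)]
    linarith
  · have hL0 : 0 ≤ L := by positivity
    refine LipschitzWith.of_dist_le_mul fun X Y => ?_
    rw [Real.coe_toNNReal _ hL0, dist_sub_left, dist_eq_norm, ← smul_sub, ← map_sub,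
      ← _root_.smul_apply, ← map_smul]
    refine (ContinuousLinearMap.le_of_opNorm_le _ hnorm _).trans
      (mul_le_mul_of_nonneg_left ?_ hL0)
    rw [dist_eq_norm, EuclideanSpace.norm_eq, EuclideanSpace.norm_eq]
    refine Real.sqrt_le_sqrt (Finset.sum_le_sum fun i _ => pow_le_pow_left₀ (norm_nonneg _) ?_ 2)
    simpa using abs_abs_sub_abs_le (X i - G i) (Y i - G i)
end

section
/- Let a < b, N ∈ ℕ with N ≥ 2, h = (b−a)/(N+1), K ≥ 0, and let 𝓐 be the N×N symmetric positive definite pentadiagonal matrix with diagonal (5, 6, …, 6, 5), first off-diagonals −4, and second off-diagonals 1. Then ‖(𝓐 + (h⁴K/2) I)⁻¹‖₂ ≤ 2(b−a)⁴ / (((b−a)⁴K + 32) h⁴), where ‖·‖₂ denotes the operator norm induced by the Euclidean norm. -/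
open Matrix

/-- The `N × N` tridiagonal second-difference matrix with diagonal `2` and off-diagonals `-1`. -/
def secondDiff (N : ℕ) : Matrix (Fin N) (Fin N) ℝ :=
  Matrix.of fun i j =>
    if i = j then 2 else if i.val + 1 = j.val ∨ j.val + 1 = i.val then -1 else 0

theorem secondDiff_transpose (N : ℕ) : (secondDiff N)ᵀ = secondDiff N := by
  ext i j
  simp only [secondDiff, transpose_apply, of_apply, eq_comm (a := j), or_comm]

theorem sum_fin_ite_val_eq (N m : ℕ) (f : ℕ → ℝ) :
    ∑ k : Fin N, (if k.val = m then f k else 0) = if m < N then f m else 0 := by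
  rw [Fin.sum_univ_eq_sum_range (fun k => if k = m then f k else 0) N, Finset.sum_ite_eq']
  simp

/-- A row of `secondDiff` applied to a sequence restricted to `Fin N`. -/
theorem sum_secondDiff_mul (N : ℕ) (i : Fin N) (f : ℕ → ℝ) :
    ∑ k : Fin N, secondDiff N i k * f k =
      2 * f i - (if i.val + 1 < N then f (i.val + 1) else 0)
        - (if 1 ≤ i.val then f (i.val - 1) else 0) := by
  have hterm : ∀ k : Fin N, secondDiff N i k * f k =
      2 * (if k.val = i.val then f k else 0) - (if k.val = i.val + 1 then f k else 0)
        - (if 1 ≤ i.val then (if k.val = i.val - 1 then f k else 0) else 0) := by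
    intro k
    simp only [secondDiff, of_apply, Fin.ext_iff]
    split_ifs <;> first | omega | ring
  simp only [hterm, Finset.sum_sub_distrib, ← Finset.mul_sum, sum_fin_ite_val_eq, i.isLt, if_true]
  congr 1
  split_ifs with hi
  · rw [sum_fin_ite_val_eq, if_pos (by omega)]
  · simp

theorem penta_eq_secondDiff_mul_self {N : ℕ} (hN : 2 ≤ N) :
    penta N = secondDiff N * secondDiff N := by
  ext i j
  have hrow := sum_secondDiff_mul N i
    (fun k => if k = j.val then 2 else if k + 1 = j.val ∨ j.val + 1 = k then -1 else 0)
  have hcol : ∀ k : Fin N, secondDiff N k j =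
      if k.val = j.val then 2 else if k.val + 1 = j.val ∨ j.val + 1 = k.val then -1 else 0 :=
    fun k => by simp only [secondDiff, of_apply, Fin.ext_iff]
  simp only [mul_apply, hcol]
  rw [hrow]
  have hi := i.isLt
  have hj := j.isLt
  simp only [penta, of_apply, Fin.ext_iff]
  split_ifs <;> first | omega | norm_num

/-- A Riccati-type partial-sum bound for the second-difference form, with the concave comparison
sequence `k ↦ (k + 1) (N - k)`. -/
theorem secondDiff_partial_sum_bound {N : ℕ} {μ : ℝ} (hμ : μ * ((N : ℝ) + 1) ^ 2 ≤ 8)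
    (hμ0 : 0 ≤ μ) (f : ℕ → ℝ) (k : ℕ) (hk : k < N) :
    ((k : ℝ) + 2) * (N - k - 1) / ((k + 1) * (N - k)) * f k ^ 2 - f k * f (k + 1) ≤
      ∑ i ∈ Finset.range (k + 1),
        f i * ((2 - μ) * f i - f (i + 1) - (if 1 ≤ i then f (i - 1) else 0)) := by
  have hμv : ∀ t : ℝ, μ * ((t + 1) * (N - t)) ≤ 2 := fun t => by
    nlinarith [mul_nonneg hμ0 (sq_nonneg ((N : ℝ) - 1 - 2 * t))]
  induction k with
  | zero =>
    have hN : (0 : ℝ) < N := by exact_mod_cast hk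
    have h0 := hμv 0
    have hr : ((0 : ℝ) + 2) * (N - 0 - 1) / ((0 + 1) * (N - 0)) ≤ 2 - μ := by
      rw [div_le_iff₀ (by linarith)]
      nlinarith
    simp only [Nat.cast_zero, zero_add, Finset.range_one, Finset.sum_singleton] at hr ⊢
    norm_num at hr ⊢
    nlinarith [mul_le_mul_of_nonneg_right hr (sq_nonneg (f 0))]
  | succ k ih =>
    have hkN : (k : ℝ) + 1 < N := by exact_mod_cast hk
    have hk0 : (0 : ℝ) ≤ k := k.cast_nonneg
    have ih := ih (by omega)
    rw [Finset.sum_range_succ]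
    refine le_trans ?_ (add_le_add_left ih _)
    have hp : 0 < ((k : ℝ) + 1) * (N - k) := mul_pos (by linarith) (by linarith)
    have hq : 0 < ((k : ℝ) + 2) * (N - k - 1) := mul_pos (by linarith) (by linarith)
    have hv := hμv (k + 1)
    set p := ((k : ℝ) + 1) * (N - k) with hpdef
    set q := ((k : ℝ) + 2) * (N - k - 1) with hqdef
    have hs : ((↑(k + 1) : ℝ) + 2) * (N - ↑(k + 1) - 1) / ((↑(k + 1) + 1) * (N - ↑(k + 1)))
        ≤ 2 - μ - p / q := by
      have hden : ((↑(k + 1) : ℝ) + 1) * (N - ↑(k + 1)) = q := by push_cast; rw [hqdef]; ring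
      rw [hden, div_le_iff₀ hq, sub_mul, div_mul_cancel₀ _ hq.ne']
      push_cast
      rw [hpdef]
      nlinarith
    have hsq : 0 ≤ q / p * f k ^ 2 - 2 * f k * f (k + 1) + p / q * f (k + 1) ^ 2 := by
      have : q / p * f k ^ 2 - 2 * f k * f (k + 1) + p / q * f (k + 1) ^ 2 =
          (q * f k - p * f (k + 1)) ^ 2 / (p * q) := by
        field_simp
        ring
      rw [this]
      positivity
    have hs' := mul_le_mul_of_nonneg_right hs (sq_nonneg (f (k + 1)))
    simp only [Nat.le_add_left, if_true, Nat.add_sub_cancel]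
    linarith

theorem secondDiff_form_lower_bound {N : ℕ} {μ : ℝ} (hμ : μ * ((N : ℝ) + 1) ^ 2 ≤ 8)
    (hμ0 : 0 ≤ μ) (x : Fin N → ℝ) :
    μ * (x ⬝ᵥ x) ≤ x ⬝ᵥ secondDiff N *ᵥ x := by
  rcases Nat.eq_zero_or_pos N with rfl | hN
  · simp [dotProduct]
  obtain ⟨k, rfl⟩ : ∃ k, N = k + 1 := ⟨N - 1, by omega⟩
  let f : ℕ → ℝ := fun i => if hi : i < k + 1 then x ⟨i, hi⟩ else 0
  have hf : ∀ i : Fin (k + 1), f i = x i := fun i => dif_pos i.isLt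
  have hf0 : f (k + 1) = 0 := by simp [f]
  have hbound := secondDiff_partial_sum_bound hμ hμ0 f k (by omega)
  rw [hf0, ← Fin.sum_univ_eq_sum_range
    (fun i => f i * ((2 - μ) * f i - f (i + 1) - (if 1 ≤ i then f (i - 1) else 0)))] at hbound
  have hform : x ⬝ᵥ secondDiff (k + 1) *ᵥ x - μ * (x ⬝ᵥ x) = ∑ i : Fin (k + 1),
      f i * ((2 - μ) * f i - f (i + 1) - (if 1 ≤ i.val then f (i - 1) else 0)) := by
    simp only [dotProduct, mulVec, Finset.mul_sum (a := μ), ← Finset.sum_sub_distrib]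
    refine Finset.sum_congr rfl fun i _ => ?_
    have hrow := sum_secondDiff_mul (k + 1) i f
    have hlast : (if i.val + 1 < k + 1 then f (i.val + 1) else 0) = f (i.val + 1) := by
      split_ifs with hi
      · rfl
      · exact (show f (i.val + 1) = 0 from dif_neg hi).symm
    rw [hlast] at hrow
    simp only [hf] at hrow
    rw [hrow, hf]
    ring
  rw [← hform] at hbound
  push_cast at hbound
  norm_num at hbound
  exact hbound

theorem penta_form_lower_bound {N : ℕ} (hN : 2 ≤ N) (x : Fin N → ℝ) :
    16 / ((N : ℝ) + 1) ^ 4 * (x ⬝ᵥ x) ≤ x ⬝ᵥ penta N *ᵥ x := by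
  have hpos : (0 : ℝ) < N + 1 := by positivity
  set μ : ℝ := 4 / ((N : ℝ) + 1) ^ 2 with hμ
  have hμ0 : 0 ≤ μ := by positivity
  have hform := secondDiff_form_lower_bound (N := N) (μ := μ)
    (by rw [hμ, div_mul_cancel₀ _ (by positivity)]; norm_num) hμ0 x
  have hsq : x ⬝ᵥ penta N *ᵥ x = (secondDiff N *ᵥ x) ⬝ᵥ (secondDiff N *ᵥ x) := by
    rw [penta_eq_secondDiff_mul_self hN, ← mulVec_mulVec, dotProduct_mulVec, ← mulVec_transpose,
      secondDiff_transpose]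
  have hμsq : 16 / ((N : ℝ) + 1) ^ 4 = μ ^ 2 := by rw [hμ, div_pow, ← pow_mul]; norm_num
  rw [hsq, hμsq]
  have hnonneg : 0 ≤ (secondDiff N *ᵥ x - μ • x) ⬝ᵥ (secondDiff N *ᵥ x - μ • x) :=
    Finset.sum_nonneg fun i _ => mul_self_nonneg _
  simp only [sub_dotProduct, dotProduct_sub, smul_dotProduct, dotProduct_smul, smul_eq_mul,
    dotProduct_comm (secondDiff N *ᵥ x) x] at hnonneg
  nlinarith [mul_le_mul_of_nonneg_left hform hμ0]

/-- A coercive real matrix has an inverse of spectral norm at most the inverse of the coercivity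
constant. -/
theorem norm_toEuclideanCLM_inv_le {n : Type*} [Fintype n] [DecidableEq n] (A : Matrix n n ℝ)
    {m : ℝ} (hm : 0 < m) (hA : ∀ x : n → ℝ, m * (x ⬝ᵥ x) ≤ x ⬝ᵥ A *ᵥ x) :
    ‖Matrix.toEuclideanCLM (𝕜 := ℝ) (n := n) A⁻¹‖ ≤ m⁻¹ := by
  have hunit : IsUnit A := by
    rw [← mulVec_injective_iff_isUnit, ← coe_mulVecLin, ← LinearMap.ker_eq_bot,
      LinearMap.ker_eq_bot']
    intro x hx
    have hle := hA x
    rw [mulVecLin_apply] at hx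
    rw [hx, dotProduct_zero] at hle
    have hxx : 0 ≤ x ⬝ᵥ x := Finset.sum_nonneg fun i _ => mul_self_nonneg _
    exact dotProduct_self_eq_zero.mp (by nlinarith)
  refine ContinuousLinearMap.opNorm_le_bound _ (by positivity) fun y => ?_
  set x := Matrix.toEuclideanCLM (𝕜 := ℝ) (n := n) A⁻¹ y with hx
  have hAx : A *ᵥ x.ofLp = y.ofLp := by
    rw [hx, ofLp_toEuclideanCLM, mulVec_mulVec,
      mul_nonsing_inv _ ((isUnit_iff_isUnit_det A).mp hunit), one_mulVec]
  have hle := hA x.ofLp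
  rw [hAx] at hle
  have hxx : x.ofLp ⬝ᵥ x.ofLp = ‖x‖ ^ 2 := by
    rw [EuclideanSpace.real_norm_sq_eq]
    simp [dotProduct, sq]
  have hxy : x.ofLp ⬝ᵥ y.ofLp ≤ ‖x‖ * ‖y‖ := by
    have := real_inner_le_norm x y
    simpa [EuclideanSpace.inner_eq_star_dotProduct, dotProduct_comm] using this
  rw [hxx] at hle
  rw [inv_mul_eq_div, le_div_iff₀ hm]
  rcases (norm_nonneg x).eq_or_lt with h0 | h0
  · rw [← h0, zero_mul]
    exact norm_nonneg y
  · refine le_of_mul_le_mul_left ?_ h0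
    linarith

/-- With `h = (b-a)/(N+1)`, the spectral norm of `(𝓐 + (h⁴K/2)I)⁻¹` is bounded by
`2(b-a)⁴/(((b-a)⁴K + 32)h⁴)`. -/
theorem inverse_norm_bound (a b : ℝ) (hab : a < b) (N : ℕ) (hN : 2 ≤ N) (K : ℝ) (hK : 0 ≤ K)
    (h : ℝ) (hh : h = (b - a) / (N + 1)) :
    ‖Matrix.toEuclideanCLM (𝕜 := ℝ) (n := Fin N)
        ((penta N + (h ^ 4 * K / 2) • (1 : Matrix (Fin N) (Fin N) ℝ))⁻¹)‖ ≤
      2 * (b - a) ^ 4 / (((b - a) ^ 4 * K + 32) * h ^ 4) := by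
  have hba : 0 < b - a := sub_pos.mpr hab
  have hpos : (0 : ℝ) < N + 1 := by positivity
  have hm : 0 < 16 / ((N : ℝ) + 1) ^ 4 + h ^ 4 * K / 2 := by positivity
  refine (norm_toEuclideanCLM_inv_le _ hm fun x => ?_).trans_eq ?_
  · rw [add_mulVec, dotProduct_add, smul_mulVec, one_mulVec, dotProduct_smul, smul_eq_mul, add_mul]
    gcongr
    exact penta_form_lower_bound hN x
  · have hden : 0 < (b - a) ^ 4 * K + 32 := by positivity
    have hsplit : 16 / ((N : ℝ) + 1) ^ 4 + h ^ 4 * K / 2 =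
        ((b - a) ^ 4 * K + 32) * h ^ 4 / (2 * (b - a) ^ 4) := by
      rw [hh]
      field_simp
      ring
    rw [hsplit, inv_div]
end
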